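/- One-period robust superhedging theorem (Bouchard–Nutz): Let (Ω,ℱ) be a measurable space, 𝒫 a convex set of probability measures, S_0 ∈ ℝ^d deterministic and S_1: Ω → ℝ^d measurable, and assume NA(𝒫) holds. Let f be a random variable. Then sup_{Q ∈ 𝒬} E_Q[f] = π(f), where π(f) = inf{x ∈ ℝ : ∃ H ∈ ℝ^d with x + H·(S_1 − S_0) ≥ f 𝒫-q.s.}. Moreover, if π(f) > −∞, then there exists H ∈ ℝ^d such that π(f) + H·(S_1 − S_0) ≥ f 𝒫-q.s. -/

import Mathlib

open MeasureTheory Filter Topology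
open scoped ENNReal NNReal

namespace RobustHS


variable {Ω : Type*} [MeasurableSpace Ω]

/-- A property `p` holds `Ps`-quasi-surely if it holds outside of a measurable set which is
null for every measure in `Ps` (equivalently, outside of a polar set). -/
def QS (Ps : Set (Measure Ω)) (p : Ω → Prop) : Prop :=
  ∃ N : Set Ω, MeasurableSet N ∧ (∀ P ∈ Ps, P N = 0) ∧ ∀ ω, ω ∉ N → p ω

/-- Convexity of a set of measures. -/
def MConvex (Ps : Set (Measure Ω)) : Prop :=
  ∀ P ∈ Ps, ∀ P' ∈ Ps, ∀ t : ℝ≥0∞, t ≤ 1 → t • P + (1 - t) • P' ∈ Ps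

/-- `Qs ≪≪ Ps` : every `Q ∈ Qs` is absolutely continuous with respect to some `P ∈ Ps`. -/
def DominatedBy (Qs Ps : Set (Measure Ω)) : Prop := ∀ Q ∈ Qs, ∃ P ∈ Ps, Q ≪ P

/-- The underlying set of the space `E`: all finite signed measures which are absolutely
continuous with respect to at least one `P ∈ Ps`. -/
def Edom (Ps : Set (Measure Ω)) : Set (SignedMeasure Ω) :=
  {μ | ∃ P ∈ Ps, μ ≪ᵥ P.toENNRealVectorMeasure}

/-- The total variation norm of a finite signed measure. -/
noncomputable def tvnorm (μ : SignedMeasure Ω) : ℝ := (μ.totalVariation Set.univ).toReal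

/-- A nonempty convex set of probability measures on `Ω`. -/
structure ConvexProbFamily (Ω : Type*) [MeasurableSpace Ω] where
  sets : Set (Measure Ω)
  nonempty : sets.Nonempty
  isProb : ∀ P ∈ sets, IsProbabilityMeasure P
  convex : MConvex sets

/-- The space `E` as a submodule of the signed measures on `Ω`. -/
noncomputable def Esub (C : ConvexProbFamily Ω) : Submodule ℝ (SignedMeasure Ω) where
  carrier := Edom C.sets
  zero_mem' := by
    obtain ⟨P, hP⟩ := C.nonempty
    exact ⟨P, hP, fun s _ => rfl⟩
  add_mem' := by
    rintro μ₁ μ₂ ⟨P₁, hP₁, hac₁⟩ ⟨P₂, hP₂, hac₂⟩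
    refine ⟨(2⁻¹ : ℝ≥0∞) • P₁ + (1 - 2⁻¹ : ℝ≥0∞) • P₂,
      C.convex P₁ hP₁ P₂ hP₂ 2⁻¹ (by simp [ENNReal.inv_le_one]), ?_⟩
    intro s hs
    rw [VectorMeasure.add_apply]
    by_cases hm : MeasurableSet s
    · rw [Measure.toENNRealVectorMeasure_apply_measurable hm, Measure.add_apply,
        Measure.smul_apply, Measure.smul_apply, smul_eq_mul, smul_eq_mul,
        add_eq_zero, mul_eq_zero, mul_eq_zero] at hs
      have h1 : P₁ s = 0 := by
        rcases hs.1 with h | h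
        · exact absurd h (by simp)
        · exact h
      have h2 : P₂ s = 0 := by
        rcases hs.2 with h | h
        · exact absurd h (by simp [ENNReal.one_sub_inv_two])
        · exact h
      rw [hac₁ (by rw [Measure.toENNRealVectorMeasure_apply_measurable hm]; exact h1),
        hac₂ (by rw [Measure.toENNRealVectorMeasure_apply_measurable hm]; exact h2), add_zero]
    · rw [VectorMeasure.not_measurable _ hm, VectorMeasure.not_measurable _ hm, add_zero]
  smul_mem' := by
    rintro c μ ⟨P, hP, hac⟩
    exact ⟨P, hP, fun s hs => by rw [VectorMeasure.smul_apply, hac hs, smul_zero]⟩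



theorem exists_hahn (s : SignedMeasure Ω) :
    ∃ i : Set Ω, MeasurableSet i ∧ (0 ≤[i] s) ∧ (s ≤[iᶜ] 0) ∧ tvnorm s = s i - s iᶜ := by
  obtain ⟨i, hi₁, hi₂, hi₃, hpos, hneg⟩ := s.toJordanDecomposition_spec
  refine ⟨i, hi₁, hi₂, hi₃, ?_⟩
  rw [tvnorm, SignedMeasure.totalVariation, Measure.add_apply, hpos, hneg,
    SignedMeasure.toMeasureOfZeroLE_apply _ hi₂ hi₁ MeasurableSet.univ,
    SignedMeasure.toMeasureOfLEZero_apply _ hi₃ hi₁.compl MeasurableSet.univ]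
  rw [← ENNReal.coe_add, ENNReal.coe_toReal, NNReal.coe_add, NNReal.coe_mk, NNReal.coe_mk]
  rw [Set.inter_univ, Set.inter_univ]
  ring

theorem apply_sub_compl_le (s : SignedMeasure Ω) {A : Set Ω} (hA : MeasurableSet A) :
    s A - s Aᶜ ≤ tvnorm s := by
  obtain ⟨i, hi₁, hi₂, hi₃, heq⟩ := exists_hahn s
  rw [heq]
  have hAi : s A = s (A ∩ i) + s (A ∩ iᶜ) := by
    conv_lhs => rw [← Set.inter_union_compl A i]
    exact s.of_union (Set.disjoint_of_subset Set.inter_subset_right Set.inter_subset_right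
      disjoint_compl_right) (hA.inter hi₁) (hA.inter hi₁.compl)
  have hiA : s i = s (A ∩ i) + s (Aᶜ ∩ i) := by
    conv_lhs => rw [← Set.inter_union_compl i A, Set.inter_comm i A, Set.inter_comm i Aᶜ]
    exact s.of_union (Set.disjoint_of_subset Set.inter_subset_left Set.inter_subset_left
      disjoint_compl_right) (hA.inter hi₁) (hA.compl.inter hi₁)
  have hAci : s Aᶜ = s (Aᶜ ∩ i) + s (Aᶜ ∩ iᶜ) := by
    conv_lhs => rw [← Set.inter_union_compl Aᶜ i]
    exact s.of_union (Set.disjoint_of_subset Set.inter_subset_right Set.inter_subset_right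
      disjoint_compl_right) (hA.compl.inter hi₁) (hA.compl.inter hi₁.compl)
  have hic : s iᶜ = s (Aᶜ ∩ iᶜ) + s (A ∩ iᶜ) := by
    conv_lhs => rw [← Set.inter_union_compl iᶜ Aᶜ, Set.inter_comm iᶜ Aᶜ, Set.inter_comm iᶜ Aᶜᶜ,
      compl_compl]
    exact s.of_union (Set.disjoint_of_subset Set.inter_subset_left Set.inter_subset_left
      disjoint_compl_left) (hA.compl.inter hi₁.compl)
      (hA.inter hi₁.compl)
  have h1 : s (A ∩ iᶜ) ≤ 0 :=
    s.nonpos_of_restrict_le_zero (s.restrict_le_zero_subset hi₁.compl Set.inter_subset_right hi₃)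
  have h2 : 0 ≤ s (Aᶜ ∩ i) :=
    s.nonneg_of_zero_le_restrict (s.zero_le_restrict_subset hi₁ Set.inter_subset_right hi₂)
  have h3 : s (Aᶜ ∩ iᶜ) ≤ 0 :=
    s.nonpos_of_restrict_le_zero (s.restrict_le_zero_subset hi₁.compl Set.inter_subset_right hi₃)
  linarith

theorem tvnorm_add_le (s t : SignedMeasure Ω) : tvnorm (s + t) ≤ tvnorm s + tvnorm t := by
  obtain ⟨i, hi₁, hi₂, hi₃, heq⟩ := exists_hahn (s + t)
  rw [heq, VectorMeasure.add_apply, VectorMeasure.add_apply]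
  have h1 := apply_sub_compl_le s hi₁
  have h2 := apply_sub_compl_le t hi₁
  linarith

theorem tvnorm_eq_zero {s : SignedMeasure Ω} (h : tvnorm s = 0) : s = 0 := by
  have hfin : s.totalVariation Set.univ ≠ ⊤ := by
    have : IsFiniteMeasure s.totalVariation := by
      rw [SignedMeasure.totalVariation]; infer_instance
    exact measure_ne_top _ _
  have hzero : s.totalVariation Set.univ = 0 := by
    rwa [tvnorm, ENNReal.toReal_eq_zero_iff, or_iff_left hfin] at h
  ext A hA
  rw [VectorMeasure.zero_apply]
  exact s.null_of_totalVariation_zero (measure_mono_null (Set.subset_univ A) hzero)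

theorem tvnorm_smul (c : ℝ) (s : SignedMeasure Ω) : tvnorm (c • s) = |c| * tvnorm s := by
  rw [tvnorm, tvnorm, SignedMeasure.totalVariation, SignedMeasure.totalVariation,
    s.toJordanDecomposition_smul_real c, JordanDecomposition.real_smul_def]
  by_cases hc : 0 ≤ c
  · rw [if_pos hc, JordanDecomposition.smul_posPart, JordanDecomposition.smul_negPart]
    rw [Measure.add_apply, Measure.add_apply, Measure.smul_apply, Measure.smul_apply,
      ← smul_add, ENNReal.toReal_smul]
    rw [abs_of_nonneg hc, NNReal.smul_def, smul_eq_mul, Real.coe_toNNReal c hc]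
  · rw [if_neg hc, JordanDecomposition.neg_posPart, JordanDecomposition.neg_negPart,
      JordanDecomposition.smul_posPart, JordanDecomposition.smul_negPart]
    rw [Measure.add_apply, Measure.add_apply, Measure.smul_apply, Measure.smul_apply,
      ← smul_add, ENNReal.toReal_smul, add_comm]
    have : |c| = -c := abs_of_neg (not_le.1 hc)
    rw [this, NNReal.smul_def, smul_eq_mul,
      Real.coe_toNNReal _ (by linarith [not_le.1 hc] : (0:ℝ) ≤ -c), neg_mul]


theorem tvnorm_neg (s : SignedMeasure Ω) : tvnorm (-s) = tvnorm s := by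
  rw [tvnorm, tvnorm, SignedMeasure.totalVariation_neg]

noncomputable instance instNormedE (C : ConvexProbFamily Ω) :
    NormedAddCommGroup (Esub C) :=
  AddGroupNorm.toNormedAddCommGroup
    { toFun := fun μ => tvnorm (μ : SignedMeasure Ω)
      map_zero' := by simp [tvnorm, SignedMeasure.totalVariation_zero]
      add_le' := fun μ ν => tvnorm_add_le μ.1 ν.1
      neg' := fun μ => tvnorm_neg μ.1
      eq_zero_of_map_eq_zero' := fun μ h => Subtype.ext (tvnorm_eq_zero h) }

noncomputable instance instNormedSpaceE (C : ConvexProbFamily Ω) :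
    NormedSpace ℝ (Esub C) where
  norm_smul_le c μ := by
    have h : tvnorm ((c • μ : Esub C) : SignedMeasure Ω) = |c| * tvnorm (μ : SignedMeasure Ω) :=
      tvnorm_smul c μ.1
    calc ‖c • μ‖ = |c| * tvnorm (μ : SignedMeasure Ω) := h
    _ ≤ ‖c‖ * ‖μ‖ := by rw [Real.norm_eq_abs]; exact le_of_eq rfl

noncomputable def sintegral (h : Ω → ℝ) (μ : SignedMeasure Ω) : ℝ :=
  ∫ ω, h ω ∂μ.toJordanDecomposition.posPart - ∫ ω, h ω ∂μ.toJordanDecomposition.negPart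

def MemLinf (Ps : Set (Measure Ω)) (h : Ω → ℝ) : Prop :=
  Measurable h ∧ ∃ M : ℝ, QS Ps fun ω => |h ω| ≤ M

def Represents (C : ConvexProbFamily Ω) (y : Esub C →L[ℝ] ℝ) (h : Ω → ℝ) : Prop :=
  ∀ μ : Esub C, y μ = sintegral h (μ : SignedMeasure Ω)

def DualSurj (C : ConvexProbFamily Ω) : Prop :=
  ∀ y : Esub C →L[ℝ] ℝ, ∃ h : Ω → ℝ, MemLinf C.sets h ∧ Represents C y h

noncomputable def linfNorm (Ps : Set (Measure Ω)) (h : Ω → ℝ) : ℝ :=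
  sInf {M : ℝ | 0 ≤ M ∧ QS Ps fun ω => |h ω| ≤ M}

def LinfRep (C : ConvexProbFamily Ω) : Type _ := {f : Ω → ℝ // MemLinf C.sets f}

instance linfSetoid (C : ConvexProbFamily Ω) : Setoid (LinfRep C) where
  r f g := QS C.sets fun ω => f.1 ω = g.1 ω
  iseqv := by
    refine ⟨fun f => ⟨∅, MeasurableSet.empty, fun P _ => measure_empty, fun ω _ => rfl⟩,
      fun {f g} hfg => ?_, fun {f g k} h₁ h₂ => ?_⟩
    · obtain ⟨N, hN, hnull, h⟩ := hfg
      exact ⟨N, hN, hnull, fun ω hω => (h ω hω).symm⟩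
    · obtain ⟨N₁, hN₁, hnull₁, hh₁⟩ := h₁
      obtain ⟨N₂, hN₂, hnull₂, hh₂⟩ := h₂
      exact ⟨N₁ ∪ N₂, hN₁.union hN₂,
        fun P hP => measure_union_null (hnull₁ P hP) (hnull₂ P hP),
        fun ω hω => (hh₁ ω fun hmem => hω (Set.mem_union_left _ hmem)).trans
          (hh₂ ω fun hmem => hω (Set.mem_union_right _ hmem))⟩

def Linf (C : ConvexProbFamily Ω) : Type _ := Quotient (linfSetoid C)

theorem sintegral_congr (C : ConvexProbFamily Ω) {f g : Ω → ℝ}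
    (hfg : QS C.sets fun ω => f ω = g ω) {μ : SignedMeasure Ω} (hμ : μ ∈ Edom C.sets) :
    sintegral f μ = sintegral g μ := by
  obtain ⟨N, hN, hnull, heq⟩ := hfg
  obtain ⟨P, hP, hac⟩ := hμ
  have htv : μ.totalVariation ≪ P := by
    have := (SignedMeasure.absolutelyContinuous_ennreal_iff μ P.toENNRealVectorMeasure).mp hac
    rwa [VectorMeasure.ennrealToMeasure_toENNRealVectorMeasure] at this
  have htvN : μ.totalVariation N = 0 := htv (hnull P hP)
  rw [SignedMeasure.totalVariation, Measure.add_apply, add_eq_zero] at htvN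
  have hsub : {ω | ¬ f ω = g ω} ⊆ N := fun ω hω => by
    by_contra hN'
    exact hω (heq ω hN')
  have h1 : f =ᵐ[μ.toJordanDecomposition.posPart] g :=
    ae_iff.mpr (measure_mono_null hsub htvN.1)
  have h2 : f =ᵐ[μ.toJordanDecomposition.negPart] g :=
    ae_iff.mpr (measure_mono_null hsub htvN.2)
  rw [sintegral, sintegral, integral_congr_ae h1, integral_congr_ae h2]

noncomputable def pairing (C : ConvexProbFamily Ω) (μ : Esub C) : Linf C → ℝ :=
  Quotient.lift (fun f : LinfRep C => sintegral f.1 (μ : SignedMeasure Ω))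
    (fun _ _ hfg => sintegral_congr C hfg μ.2)

noncomputable instance instTopLinf (C : ConvexProbFamily Ω) : TopologicalSpace (Linf C) :=
  ⨅ μ : Esub C, TopologicalSpace.induced (pairing C μ) inferInstance



/-- The gain of the one-period portfolio with strategy `H`: `H · (S₁ - S₀)`. -/
def gain {d : ℕ} (H : Fin d → ℝ) (S0 : Fin d → ℝ) (S1 : Ω → Fin d → ℝ) (ω : Ω) : ℝ :=
  ∑ i, H i * (S1 ω i - S0 i)

/-- The robust no-arbitrage condition `NA(𝒫)` of Bouchard-Nutz (one-period case). -/
def NAcond (Ps : Set (Measure Ω)) {d : ℕ} (S0 : Fin d → ℝ) (S1 : Ω → Fin d → ℝ) : Prop :=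
  ∀ H : Fin d → ℝ, QS Ps (fun ω => 0 ≤ gain H S0 S1 ω) → QS Ps (fun ω => gain H S0 S1 ω = 0)

/-- The expectation `E_Q[f] = E_Q[f⁺] - E_Q[f⁻]`, valued in `EReal`, with the convention
`∞ - ∞ = -∞` (which holds for `EReal` subtraction). -/
noncomputable def convExp (Q : Measure Ω) (f : Ω → ℝ) : EReal :=
  ((∫⁻ ω, ENNReal.ofReal (f ω) ∂Q : ℝ≥0∞) : EReal) -
    ((∫⁻ ω, ENNReal.ofReal (-f ω) ∂Q : ℝ≥0∞) : EReal)

/-- The set `𝒬` of martingale measures dominated by some measure of `Ps`. -/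
def MartSet (Ps : Set (Measure Ω)) {d : ℕ} (S0 : Fin d → ℝ) (S1 : Ω → Fin d → ℝ) :
    Set (Measure Ω) :=
  {Q | IsProbabilityMeasure Q ∧ (∃ P ∈ Ps, Q ≪ P) ∧
    ∀ i : Fin d, convExp Q (fun ω => S1 ω i - S0 i) = 0}

section LargeMarket

variable {Ωs : ℕ → Type*} [∀ n, MeasurableSpace (Ωs n)]

/-- A robust large financial market: a sequence of one-period robust markets. -/
structure LargeMarket (Ωs : ℕ → Type*) [∀ n, MeasurableSpace (Ωs n)] where
  d : ℕ → ℕ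
  S0 : ∀ n, Fin (d n) → ℝ
  S1 : ∀ n, Ωs n → Fin (d n) → ℝ
  meas_S1 : ∀ n i, Measurable fun ω => S1 n ω i

/-- Asymptotic arbitrage of the first kind for the sequence of uncertainty sets `Ps`. -/
def AA1 (M : LargeMarket Ωs) (Ps : ∀ n, Set (Measure (Ωs n))) : Prop :=
  ∃ nk : ℕ → ℕ, StrictMono nk ∧
    ∃ H : ∀ k, Fin (M.d (nk k)) → ℝ, ∃ c : ℕ → ℝ,
      (∀ k, 0 < c k) ∧ Tendsto c atTop (nhds 0) ∧
      (∀ k, QS (Ps (nk k)) fun ω => -(c k) ≤ gain (H k) (M.S0 (nk k)) (M.S1 (nk k)) ω) ∧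
      ∃ α : ℝ, 0 < α ∧ ∃ Pk : ∀ k, Measure (Ωs (nk k)),
        (∀ k, Pk k ∈ Ps (nk k)) ∧
        ∀ k, ENNReal.ofReal α ≤ Pk k {ω | α ≤ gain (H k) (M.S0 (nk k)) (M.S1 (nk k)) ω}

/-- No asymptotic arbitrage of the first kind. -/
def NAA1 (M : LargeMarket Ωs) (Ps : ∀ n, Set (Measure (Ωs n))) : Prop := ¬ AA1 M Ps

/-- Asymptotic arbitrage of the second kind. -/
def AA2 (M : LargeMarket Ωs) (Ps : ∀ n, Set (Measure (Ωs n))) : Prop :=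
  ∃ nk : ℕ → ℕ, StrictMono nk ∧
    ∃ H : ∀ k, Fin (M.d (nk k)) → ℝ,
      (∀ k, QS (Ps (nk k)) fun ω => -1 ≤ gain (H k) (M.S0 (nk k)) (M.S1 (nk k)) ω) ∧
      ∃ α : ℝ, 0 < α ∧ ∃ Pk : ∀ k, Measure (Ωs (nk k)),
        (∀ k, Pk k ∈ Ps (nk k)) ∧
        Tendsto (fun k => Pk k {ω | α ≤ gain (H k) (M.S0 (nk k)) (M.S1 (nk k)) ω})
          atTop (nhds 1)

/-- No asymptotic arbitrage of the second kind. -/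
def NAA2 (M : LargeMarket Ωs) (Ps : ∀ n, Set (Measure (Ωs n))) : Prop := ¬ AA2 M Ps

/-- `(Pₙ)` is contiguous with respect to `(Qₙ)`. -/
def Contiguous (P Q : ∀ n, Measure (Ωs n)) : Prop :=
  ∀ A : ∀ n, Set (Ωs n), (∀ n, MeasurableSet (A n)) →
    Tendsto (fun n => Q n (A n)) atTop (nhds 0) → Tendsto (fun n => P n (A n)) atTop (nhds 0)

/-- The sequence of sets `R n` of probability measures is weakly contiguous
with respect to `(Pₙ)`. -/
def WeaklyContiguous (R : ∀ n, Set (Measure (Ωs n))) (P : ∀ n, Measure (Ωs n)) : Prop :=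
  ∀ ε : ℝ, 0 < ε → ∃ δ : ℝ, 0 < δ ∧ ∃ Q : ∀ n, Measure (Ωs n), (∀ n, Q n ∈ R n) ∧
    ∀ n, ∀ A : Set (Ωs n), MeasurableSet A →
      P n A < ENNReal.ofReal δ → Q n A < ENNReal.ofReal ε

end LargeMarket



/-- The superhedging price `π(f)`, valued in `EReal`. -/
noncomputable def shPrice {Ω : Type*} [MeasurableSpace Ω] (Ps : Set (Measure Ω))
    {d : ℕ} (S0 : Fin d → ℝ) (S1 : Ω → Fin d → ℝ) (f : Ω → ℝ) : EReal :=
  sInf {x : EReal | ∃ r : ℝ, x = (r : EReal) ∧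
    ∃ H : Fin d → ℝ, QS Ps fun ω => f ω ≤ r + gain H S0 S1 ω}

/-- A convex subset of a finite-dimensional space that does not contain the origin can be
properly separated from the origin. -/
theorem exists_proper_separation {E : Type*} [NormedAddCommGroup E] [NormedSpace ℝ E]
    [FiniteDimensional ℝ E] {C : Set E} (hC : Convex ℝ C) (hne : C.Nonempty)
    (h0 : (0 : E) ∉ C) :
    ∃ l : E →ₗ[ℝ] ℝ, (∀ x ∈ C, 0 ≤ l x) ∧ ∃ x ∈ C, 0 < l x := by
  obtain ⟨x₀, hx₀⟩ := hne
  set W : Submodule ℝ E := Submodule.span ℝ C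
  set K : Set W := {w | ∃ t : ℝ, 0 < t ∧ t • (w : E) ∈ C}
  have hCK : ∀ x (hx : x ∈ C), (⟨x, Submodule.subset_span hx⟩ : W) ∈ K :=
    fun x hx => ⟨1, one_pos, by simpa using hx⟩
  have hK0 : (0 : W) ∉ K := fun ⟨t, _, ht⟩ => h0 (by simpa using ht)
  have hKc : Convex ℝ K := by
    rw [convex_iff_forall_pos]
    rintro x ⟨s, hs, hsx⟩ y ⟨t, ht, hty⟩ a b ha hb -
    have hp : 0 < a / s + b / t := by positivity
    refine ⟨(a / s + b / t)⁻¹, inv_pos.2 hp, ?_⟩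
    have := hC hsx hty (a := (a / s + b / t)⁻¹ * (a / s)) (b := (a / s + b / t)⁻¹ * (b / t))
      (by positivity) (by positivity) (by rw [← mul_add, inv_mul_cancel₀ hp.ne'])
    convert this using 1
    simp only [Submodule.coe_add, Submodule.coe_smul, smul_add, smul_smul]
    congr 2 <;> field_simp
  have hKs : affineSpan ℝ K = ⊤ := by
    rw [AffineSubspace.affineSpan_eq_top_iff_vectorSpan_eq_top_of_nonempty ℝ W W
      ⟨_, hCK x₀ hx₀⟩]
    have hv : ∀ x (hx : x ∈ C), (⟨x, Submodule.subset_span hx⟩ : W) ∈ vectorSpan ℝ K := by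
      intro x hx
      have h2 : ((2 : ℝ) • (⟨x, Submodule.subset_span hx⟩ : W)) ∈ K :=
        ⟨2⁻¹, by norm_num, by simpa using hx⟩
      have := vsub_mem_vectorSpan ℝ h2 (hCK x hx)
      rwa [vsub_eq_sub, two_smul, add_sub_cancel_right] at this
    rw [eq_top_iff]
    rintro ⟨w, hw⟩ -
    have hmap : W ≤ (vectorSpan ℝ K).map W.subtype :=
      Submodule.span_le.2 fun x hx => ⟨_, hv x hx, rfl⟩
    obtain ⟨v, hv', hvw⟩ := hmap hw
    have : v = ⟨w, hw⟩ := Subtype.ext hvw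
    exact this ▸ hv'
  have hint : (interior K).Nonempty := hKc.interior_nonempty_iff_affineSpan_eq_top.2 hKs
  obtain ⟨g, hg⟩ := geometric_hahn_banach_point_open hKc.interior isOpen_interior
    (fun h => hK0 (interior_subset h) : (0 : W) ∉ interior K)
  simp only [map_zero] at hg
  have hgK : ∀ w ∈ K, 0 ≤ g w := by
    have hcl : closure (interior K) ⊆ {w | 0 ≤ g w} :=
      closure_minimal (fun w hw => (hg w hw).le) (isClosed_le continuous_const g.continuous)
    rw [hKc.closure_interior_eq_closure_of_nonempty_interior hint] at hcl
    exact fun w hw => hcl (subset_closure hw)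
  obtain ⟨l, hl⟩ := LinearMap.exists_extend (g : W →ₗ[ℝ] ℝ)
  have hlg : ∀ w : W, l w = g w := fun w => LinearMap.congr_fun hl w
  refine ⟨l, fun x hx => ?_, ?_⟩
  · exact (hlg ⟨x, Submodule.subset_span hx⟩).symm ▸ hgK _ (hCK x hx)
  · obtain ⟨w, hw⟩ := hint
    obtain ⟨t, ht, htw⟩ := interior_subset hw
    refine ⟨_, htw, ?_⟩
    rw [map_smul, hlg, smul_eq_mul]
    exact mul_pos ht (hg w hw)

theorem convExp_mono {Q : Measure Ω} {f g : Ω → ℝ} (h : f ≤ᵐ[Q] g) :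
    convExp Q f ≤ convExp Q g := by
  refine EReal.sub_le_sub ?_ ?_
  · exact EReal.coe_ennreal_le_coe_ennreal_iff.2
      (lintegral_mono_ae (h.mono fun ω hω => ENNReal.ofReal_le_ofReal hω))
  · exact EReal.coe_ennreal_le_coe_ennreal_iff.2
      (lintegral_mono_ae (h.mono fun ω hω => ENNReal.ofReal_le_ofReal (neg_le_neg hω)))

theorem convExp_eq_integral {Q : Measure Ω} {f : Ω → ℝ} (hf : Integrable f Q) :
    convExp Q f = ((∫ ω, f ω ∂Q : ℝ) : EReal) := by
  rw [integral_eq_lintegral_pos_part_sub_lintegral_neg_part hf, EReal.coe_sub,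
    EReal.coe_ennreal_toReal hf.lintegral_lt_top.ne,
    EReal.coe_ennreal_toReal (Integrable.lintegral_lt_top (f := fun ω => -f ω) hf.neg).ne]
  rfl

theorem integrable_of_convExp_eq_zero {Q : Measure Ω} {f : Ω → ℝ} (hf : Measurable f)
    (h : convExp Q f = 0) : Integrable f Q := by
  have hp : ∫⁻ ω, ENNReal.ofReal (f ω) ∂Q ≠ ⊤ := by
    intro ht
    rw [convExp, ht] at h
    generalize ∫⁻ ω, ENNReal.ofReal (-f ω) ∂Q = b at h
    induction b <;> simp at h
  have hn : ∫⁻ ω, ENNReal.ofReal (-f ω) ∂Q ≠ ⊤ := by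
    intro ht
    rw [convExp, ht] at h
    simp at h
  refine ⟨hf.aestronglyMeasurable, ?_⟩
  rw [hasFiniteIntegral_iff_norm]
  calc ∫⁻ ω, ENNReal.ofReal ‖f ω‖ ∂Q
      ≤ ∫⁻ ω, (ENNReal.ofReal (f ω) + ENNReal.ofReal (-f ω)) ∂Q := by
        refine lintegral_mono fun ω => ?_
        rcases le_total 0 (f ω) with h0 | h0
        · rw [Real.norm_of_nonneg h0]; exact le_self_add
        · rw [Real.norm_of_nonpos h0]; exact le_add_self
    _ < ⊤ := by
        rw [lintegral_add_left hf.ennreal_ofReal]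
        exact ENNReal.add_lt_top.2 ⟨hp.lt_top, hn.lt_top⟩

theorem QS.ae {Ps : Set (Measure Ω)} {p : Ω → Prop} (h : QS Ps p) {P Q : Measure Ω}
    (hP : P ∈ Ps) (hQ : Q ≪ P) : ∀ᵐ ω ∂Q, p ω := by
  obtain ⟨N, -, hnull, hp⟩ := h
  exact measure_mono_null (fun ω hω => by_contra fun hn => hω (hp ω hn)) (hQ (hnull P hP))

/-- Weak duality: a martingale measure prices any claim below its superhedging costs. -/
theorem convExp_le_of_superhedge {Ps : Set (Measure Ω)} {d : ℕ} {S0 : Fin d → ℝ}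
    {S1 : Ω → Fin d → ℝ} (hS1 : ∀ i, Measurable fun ω => S1 ω i) {f : Ω → ℝ} {Q : Measure Ω}
    (hQ : Q ∈ MartSet Ps S0 S1) {r : ℝ} {H : Fin d → ℝ}
    (h : QS Ps fun ω => f ω ≤ r + gain H S0 S1 ω) : convExp Q f ≤ r := by
  obtain ⟨hprob, ⟨P, hP, hQP⟩, hmart⟩ := hQ
  have hint : ∀ i, Integrable (fun ω => S1 ω i - S0 i) Q := fun i =>
    integrable_of_convExp_eq_zero ((hS1 i).sub_const _) (hmart i)
  have hzero : ∀ i, ∫ ω, (S1 ω i - S0 i) ∂Q = 0 := fun i => by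
    have := hmart i
    rw [convExp_eq_integral (hint i)] at this
    exact_mod_cast this
  have hgain : Integrable (gain H S0 S1) Q :=
    integrable_finsetSum _ fun i _ => (hint i).const_mul (H i)
  refine (convExp_mono (h.ae hP hQP)).trans ?_
  rw [convExp_eq_integral (f := fun ω => r + gain H S0 S1 ω) ((integrable_const r).add hgain),
    integral_add (integrable_const r) hgain]
  simp only [gain]
  rw [integral_finsetSum _ fun i _ => (hint i).const_mul (H i)]
  simp [integral_const_mul, hzero]

/-- The integrals `(E_R[Z], E_R[f])` under the probability measures `μ` that are dominated by an
element of `Ps` and integrate both `Z` and `f`. -/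
def momentSet (Ps : Set (Measure Ω)) {d : ℕ} (Z : Fin d → Ω → ℝ) (f : Ω → ℝ) :
    Set ((Fin d → ℝ) × ℝ) :=
  {p | ∃ μ : Measure Ω, IsProbabilityMeasure μ ∧ (∃ P ∈ Ps, μ ≪ P) ∧
    (∀ i, Integrable (Z i) μ) ∧ Integrable f μ ∧
    (∀ i, p.1 i = ∫ ω, Z i ω ∂μ) ∧ p.2 = ∫ ω, f ω ∂μ}

theorem convex_momentSet {Ps : Set (Measure Ω)} (hconv : MConvex Ps) {d : ℕ}
    (Z : Fin d → Ω → ℝ) (f : Ω → ℝ) : Convex ℝ (momentSet Ps Z f) := by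
  rintro p ⟨μ, hμ, ⟨P, hP, hμP⟩, hZ, hf, hp1, hp2⟩ q ⟨ν, hν, ⟨P', hP', hνP⟩, hZ', hf', hq1, hq2⟩
    a b ha hb hab
  have hint : ∀ {g : Ω → ℝ}, Integrable g μ → Integrable g ν →
      Integrable g (ENNReal.ofReal a • μ + ENNReal.ofReal b • ν) ∧
      ∫ ω, g ω ∂(ENNReal.ofReal a • μ + ENNReal.ofReal b • ν)
        = a * ∫ ω, g ω ∂μ + b * ∫ ω, g ω ∂ν := by
    intro g hg hg'
    have h1 := hg.smul_measure (c := ENNReal.ofReal a) ENNReal.ofReal_ne_top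
    have h2 := hg'.smul_measure (c := ENNReal.ofReal b) ENNReal.ofReal_ne_top
    refine ⟨h1.add_measure h2, ?_⟩
    rw [integral_add_measure h1 h2, integral_smul_measure, integral_smul_measure,
      ENNReal.toReal_ofReal ha, ENNReal.toReal_ofReal hb, smul_eq_mul, smul_eq_mul]
  refine ⟨ENNReal.ofReal a • μ + ENNReal.ofReal b • ν, ⟨?_⟩,
    ⟨(2⁻¹ : ℝ≥0∞) • P + (1 - 2⁻¹ : ℝ≥0∞) • P', hconv P hP P' hP' 2⁻¹ (by simp), ?_⟩,
    fun i => (hint (hZ i) (hZ' i)).1, (hint hf hf').1, fun i => ?_, ?_⟩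
  · simp [← ENNReal.ofReal_add ha hb, hab]
  · intro s hs
    simp only [Measure.add_apply, Measure.smul_apply, smul_eq_mul, add_eq_zero, mul_eq_zero,
      ENNReal.one_sub_inv_two, ENNReal.inv_eq_zero, ENNReal.ofNat_ne_top, false_or] at hs
    simp [hμP hs.1, hνP hs.2]
  · rw [(hint (hZ i) (hZ' i)).2, ← hp1, ← hq1]
    simp
  · rw [(hint hf hf').2, ← hp2, ← hq2]
    simp

/-- A non-null measurable set carries a probability measure, dominated by the given one, under
which finitely many given functions are integrable. -/
theorem exists_isProbabilityMeasure_integrable {P : Measure Ω} [IsFiniteMeasure P] {ι : Type*}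
    [Finite ι] {g : ι → Ω → ℝ} (hg : ∀ i, Measurable (g i)) {A : Set Ω} (hA : MeasurableSet A)
    (hPA : P A ≠ 0) :
    ∃ μ : Measure Ω, IsProbabilityMeasure μ ∧ μ ≪ P ∧ (∀ᵐ ω ∂μ, ω ∈ A) ∧
      ∀ i, Integrable (g i) μ := by
  have := Fintype.ofFinite ι
  obtain ⟨n, hn⟩ : ∃ n : ℕ, P (A ∩ {ω | ∀ i, |g i ω| ≤ n}) ≠ 0 := by
    by_contra! h
    refine hPA (measure_mono_null (fun ω hω => ?_) (measure_iUnion_null h))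
    obtain ⟨n, hn⟩ := exists_nat_ge (∑ i, |g i ω|)
    exact Set.mem_iUnion.2 ⟨n, hω, fun i =>
      (Finset.single_le_sum (fun j _ => abs_nonneg (g j ω)) (Finset.mem_univ i)).trans hn⟩
  have hm : MeasurableSet (A ∩ {ω | ∀ i, |g i ω| ≤ n}) := by
    refine hA.inter ?_
    rw [Set.ofPred_forall]
    exact MeasurableSet.iInter fun i => measurableSet_le (hg i).abs measurable_const
  have hprob := ProbabilityTheory.cond_isProbabilityMeasure hn
  have hmem := ProbabilityTheory.ae_cond_mem (μ := P) hm
  refine ⟨_, hprob, ProbabilityTheory.cond_absolutelyContinuous, hmem.mono fun ω h => h.1,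
    fun i => ?_⟩
  exact Integrable.of_bound (hg i).aestronglyMeasurable n (hmem.mono fun ω h => h.2 i)

/-- A linear inequality on the moment set is a quasi-sure inequality. -/
theorem qs_le_zero_of_momentSet {Ps : Set (Measure Ω)} (hprob : ∀ P ∈ Ps, IsProbabilityMeasure P)
    {d : ℕ} {Z : Fin d → Ω → ℝ} (hZ : ∀ i, Measurable (Z i)) {f : Ω → ℝ} (hf : Measurable f)
    {h : Fin d → ℝ} {a c : ℝ}
    (hle : ∀ p ∈ momentSet Ps Z f, c + ∑ i, h i * p.1 i + a * p.2 ≤ 0) :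
    QS Ps fun ω => c + ∑ i, h i * Z i ω + a * f ω ≤ 0 := by
  have hsum : Measurable fun ω => ∑ i, h i * Z i ω :=
    Finset.measurable_fun_sum _ fun i _ => (hZ i).const_mul (h i)
  have hA : MeasurableSet {ω | 0 < c + ∑ i, h i * Z i ω + a * f ω} :=
    measurableSet_lt measurable_const ((hsum.const_add c).add (hf.const_mul a))
  refine ⟨_, hA, fun P hP => ?_, fun ω hω => not_lt.1 hω⟩
  by_contra hPA
  have := hprob P hP
  obtain ⟨μ, hμ, hμP, hμA, hint⟩ := exists_isProbabilityMeasure_integrable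
    (g := fun o : Option (Fin d) => o.elim f Z) (by rintro (_ | i); exacts [hf, hZ i]) hA hPA
  have hfi : Integrable f μ := hint none
  have hZi : ∀ i, Integrable (Z i) μ := fun i => hint (some i)
  have hle' := hle (fun i => ∫ ω, Z i ω ∂μ, ∫ ω, f ω ∂μ)
    ⟨μ, hμ, ⟨P, hP, hμP⟩, hZi, hfi, fun _ => rfl, rfl⟩
  have hsi : Integrable (fun ω => ∑ i, h i * Z i ω) μ :=
    integrable_finsetSum _ fun i _ => (hZi i).const_mul (h i)
  have hcs : Integrable (fun ω => c + ∑ i, h i * Z i ω) μ := (integrable_const c).add hsi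
  have hG : Integrable (fun ω => c + ∑ i, h i * Z i ω + a * f ω) μ := hcs.add (hfi.const_mul a)
  have hpos : 0 < ∫ ω, (c + ∑ i, h i * Z i ω + a * f ω) ∂μ := by
    rw [integral_pos_iff_support_of_nonneg_ae (hμA.mono fun ω hω => le_of_lt hω) hG]
    have : Function.support (fun ω => c + ∑ i, h i * Z i ω + a * f ω) =ᵐ[μ] Set.univ :=
      eventuallyEq_univ.2 (hμA.mono fun ω hω => ne_of_gt hω)
    rw [measure_congr this]
    simp
  rw [integral_add hcs (hfi.const_mul a), integral_add (integrable_const c) hsi,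
    integral_finsetSum _ fun i _ => (hZi i).const_mul (h i)] at hpos
  simp only [integral_const_mul, integral_const, probReal_univ, one_smul] at hpos
  exact absurd hle' (not_le.2 hpos)

theorem momentSet_nonempty {Ps : Set (Measure Ω)} (hprob : ∀ P ∈ Ps, IsProbabilityMeasure P)
    (hne : Ps.Nonempty) {d : ℕ} {Z : Fin d → Ω → ℝ} (hZ : ∀ i, Measurable (Z i)) {f : Ω → ℝ}
    (hf : Measurable f) : (momentSet Ps Z f).Nonempty := by
  obtain ⟨P, hP⟩ := hne
  have := hprob P hP
  obtain ⟨μ, hμ, hμP, -, hint⟩ := exists_isProbabilityMeasure_integrable (P := P)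
    (g := fun o : Option (Fin d) => o.elim f Z) (by rintro (_ | i); exacts [hf, hZ i])
    MeasurableSet.univ (by simp)
  exact ⟨(fun i => ∫ ω, Z i ω ∂μ, ∫ ω, f ω ∂μ), μ, hμ, ⟨P, hP, hμP⟩, fun i => hint (some i),
    hint none, fun _ => rfl, rfl⟩

theorem linearMap_eq_sum {d : ℕ} (l : (Fin d → ℝ) × ℝ →ₗ[ℝ] ℝ) (p : (Fin d → ℝ) × ℝ) :
    l p = ∑ i, l (Pi.single i 1, 0) * p.1 i + l (0, 1) * p.2 := by
  have h : p = LinearMap.inl ℝ (Fin d → ℝ) ℝ p.1 + p.2 • ((0, 1) : (Fin d → ℝ) × ℝ) := by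
    ext <;> simp
  conv_lhs => rw [h]
  rw [map_add, map_smul, ← LinearMap.comp_apply, LinearMap.pi_apply_eq_sum_univ]
  have hs : ∀ i : Fin d, (fun j => if i = j then (1 : ℝ) else 0) = Pi.single i 1 := fun i => by
    ext j; simp [Pi.single_apply, eq_comm]
  simp only [hs, LinearMap.comp_apply, LinearMap.inl_apply, smul_eq_mul, mul_comm]

/-- Under no arbitrage, a functional of the price increments that is nonnegative on the moment set
vanishes there. -/
theorem NAcond.momentSet_eq_zero {Ps : Set (Measure Ω)}
    (hprob : ∀ P ∈ Ps, IsProbabilityMeasure P) {d : ℕ} {S0 : Fin d → ℝ} {S1 : Ω → Fin d → ℝ}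
    (hS1 : ∀ i, Measurable fun ω => S1 ω i) (hNA : NAcond Ps S0 S1) {f : Ω → ℝ}
    (hf : Measurable f) {h : Fin d → ℝ}
    (hh : ∀ p ∈ momentSet Ps (fun i ω => S1 ω i - S0 i) f, 0 ≤ ∑ i, h i * p.1 i)
    {p : (Fin d → ℝ) × ℝ} (hp : p ∈ momentSet Ps (fun i ω => S1 ω i - S0 i) f) :
    ∑ i, h i * p.1 i = 0 := by
  have hqs : QS Ps fun ω => 0 ≤ gain h S0 S1 ω := by
    obtain ⟨N, hN, hnull, hle⟩ := qs_le_zero_of_momentSet hprob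
      (fun i => (hS1 i).sub_const (S0 i)) hf (h := -h) (a := 0) (c := 0)
      (fun p hp => by simpa using hh p hp)
    exact ⟨N, hN, hnull, fun ω hω => by simpa [gain] using hle ω hω⟩
  obtain ⟨μ, hμ, ⟨P, hP, hμP⟩, hZ, -, hp1, -⟩ := hp
  calc ∑ i, h i * p.1 i = ∫ ω, gain h S0 S1 ω ∂μ := by
        simp only [gain]
        rw [integral_finsetSum _ fun i _ => (hZ i).const_mul (h i)]
        simp only [integral_const_mul, hp1]
    _ = 0 := by
        rw [integral_congr_ae ((hNA h hqs).ae hP hμP)]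
        simp

/-- Under no arbitrage, there is a martingale measure that integrates a given claim. -/
theorem exists_zero_mem_momentSet {Ps : Set (Measure Ω)}
    (hprob : ∀ P ∈ Ps, IsProbabilityMeasure P) (hne : Ps.Nonempty) (hconv : MConvex Ps) {d : ℕ}
    {S0 : Fin d → ℝ} {S1 : Ω → Fin d → ℝ} (hS1 : ∀ i, Measurable fun ω => S1 ω i)
    (hNA : NAcond Ps S0 S1) {f : Ω → ℝ} (hf : Measurable f) :
    ∃ v : ℝ, ((0, v) : (Fin d → ℝ) × ℝ) ∈ momentSet Ps (fun i ω => S1 ω i - S0 i) f := by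
  by_contra! hcon
  set M := momentSet Ps (fun i ω => S1 ω i - S0 i) f
  have hMne : M.Nonempty := momentSet_nonempty hprob hne (fun i => (hS1 i).sub_const (S0 i)) hf
  obtain ⟨l, hl, y, ⟨p, hp, rfl⟩, hly⟩ := exists_proper_separation
    ((convex_momentSet hconv _ f).linear_image (LinearMap.fst ℝ (Fin d → ℝ) ℝ))
    (hMne.image _) (by rintro ⟨⟨y, v⟩, hp, rfl : y = 0⟩; exact hcon v hp)
  have hsum : ∀ q : (Fin d → ℝ) × ℝ, l q.1 = ∑ i, l (Pi.single i 1) * q.1 i := fun q => by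
    have := linearMap_eq_sum (l ∘ₗ LinearMap.fst ℝ (Fin d → ℝ) ℝ) q
    simpa using this
  refine hly.ne' ((hsum p).trans (hNA.momentSet_eq_zero hprob hS1 hf (fun q hq => ?_) hp))
  rw [← hsum]
  exact hl _ ⟨q, hq, rfl⟩

/-- If every martingale measure integrating `f` prices it at most at `c`, then `f` can be
superhedged from the initial capital `c`. -/
theorem exists_superhedge {Ps : Set (Measure Ω)}
    (hprob : ∀ P ∈ Ps, IsProbabilityMeasure P) (hne : Ps.Nonempty) (hconv : MConvex Ps) {d : ℕ}
    {S0 : Fin d → ℝ} {S1 : Ω → Fin d → ℝ} (hS1 : ∀ i, Measurable fun ω => S1 ω i)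
    (hNA : NAcond Ps S0 S1) {f : Ω → ℝ} (hf : Measurable f) {c : ℝ}
    (hc : ∀ v : ℝ, ((0, v) : (Fin d → ℝ) × ℝ) ∈ momentSet Ps (fun i ω => S1 ω i - S0 i) f →
      v ≤ c) :
    ∃ H : Fin d → ℝ, QS Ps fun ω => f ω ≤ c + gain H S0 S1 ω := by
  have hZ : ∀ i, Measurable fun ω => S1 ω i - S0 i := fun i => (hS1 i).sub_const (S0 i)
  set M := momentSet Ps (fun i ω => S1 ω i - S0 i) f
  have hMconv : Convex ℝ M := convex_momentSet hconv _ f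
  have hMne : M.Nonempty := momentSet_nonempty hprob hne hZ hf
  set C : Set ((Fin d → ℝ) × ℝ) := {q | ∃ v : ℝ, (q.1, v) ∈ M ∧ c - v < q.2}
  have hC : Convex ℝ C := by
    rintro ⟨y, w⟩ ⟨v, hv, hw⟩ ⟨y', w'⟩ ⟨v', hv', hw'⟩ a b ha hb hab
    refine ⟨a * v + b * v', hMconv hv hv' ha hb hab, ?_⟩
    simp only [Prod.snd_add, Prod.smul_snd, smul_eq_mul] at hw hw' ⊢
    have hs : 0 < a * (w - (c - v)) + b * (w' - (c - v')) := by
      rcases ha.eq_or_lt with rfl | ha'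
      · have : b = 1 := by linarith
        subst this; linarith
      · have := mul_pos ha' (sub_pos.2 hw)
        have := mul_nonneg hb (sub_pos.2 hw').le
        linarith
    have hcab : c = a * c + b * c := by rw [← add_mul, hab, one_mul]
    linarith
  have hmem : ∀ p ∈ M, ∀ w, c - p.2 < w → (p.1, w) ∈ C := fun p hp w hw => ⟨p.2, hp, hw⟩
  obtain ⟨p₀, hp₀⟩ := hMne
  obtain ⟨l, hl, ⟨y, w⟩, ⟨v, hv, hw⟩, hpos⟩ := exists_proper_separation hC
    ⟨_, hmem p₀ hp₀ _ (lt_add_one _)⟩ (fun ⟨v, hv, hw⟩ => by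
      have := hc v hv
      simp only [Prod.snd_zero] at hw
      linarith)
  set h : Fin d → ℝ := fun i => l (Pi.single i 1, 0)
  set a := l (0, 1)
  have hlsum : ∀ q, l q = ∑ i, h i * q.1 i + a * q.2 := linearMap_eq_sum l
  have hlim : ∀ p ∈ M, 0 ≤ ∑ i, h i * p.1 i + a * (c - p.2) := by
    intro p hp
    have ht : Tendsto (fun w : ℝ => ∑ i, h i * p.1 i + a * w) (𝓝[>] (c - p.2))
        (𝓝 (∑ i, h i * p.1 i + a * (c - p.2))) :=
      (Continuous.tendsto (by fun_prop) _).mono_left nhdsWithin_le_nhds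
    refine ge_of_tendsto ht (eventually_mem_nhdsWithin.mono fun w hw => ?_)
    have := hl _ (hmem p hp w hw)
    rwa [hlsum] at this
  have ha0 : 0 ≤ a := by
    by_contra! hneg
    have ht : Tendsto (fun w : ℝ => ∑ i, h i * p₀.1 i + a * w) atTop atBot :=
      tendsto_atBot_add_const_left _ _ (tendsto_id.const_mul_atTop_of_neg hneg)
    obtain ⟨w, hw1, hw2⟩ := ((ht.eventually_lt_atBot 0).and (eventually_gt_atTop (c - p₀.2))).exists
    have := hl _ (hmem p₀ hp₀ w hw2)
    rw [hlsum] at this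
    exact absurd this (not_le.2 hw1)
  have hapos : 0 < a := by
    refine ha0.lt_of_ne fun h0 => hpos.ne' ?_
    have hz := hNA.momentSet_eq_zero hprob hS1 hf (h := h)
      (fun p hp => by simpa [← h0] using hlim p hp) hv
    rw [hlsum, ← h0]
    simpa using hz
  obtain ⟨N, hN, hnull, hle⟩ := qs_le_zero_of_momentSet hprob hZ hf (h := -h) (a := a)
    (c := -(a * c)) (fun p hp => by
      have := hlim p hp
      simp only [Pi.neg_apply, neg_mul, Finset.sum_neg_distrib]
      linarith)
  refine ⟨fun i => h i / a, N, hN, hnull, fun ω hω => ?_⟩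
  have := hle ω hω
  simp only [Pi.neg_apply, neg_mul, Finset.sum_neg_distrib] at this
  have hg : a * gain (fun i => h i / a) S0 S1 ω = ∑ i, h i * (S1 ω i - S0 i) := by
    rw [gain, Finset.mul_sum]
    exact Finset.sum_congr rfl fun i _ => by field_simp
  refine le_of_mul_le_mul_left ?_ hapos
  rw [mul_add, hg]
  linarith

/-- A point of the moment set over the origin is the price under a martingale measure. -/
theorem coe_le_iSup_convExp {Ps : Set (Measure Ω)} {d : ℕ} {S0 : Fin d → ℝ}
    {S1 : Ω → Fin d → ℝ} {f : Ω → ℝ} {v : ℝ}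
    (hv : ((0, v) : (Fin d → ℝ) × ℝ) ∈ momentSet Ps (fun i ω => S1 ω i - S0 i) f) :
    (v : EReal) ≤ ⨆ Q : MartSet Ps S0 S1, convExp (Q : Measure Ω) f := by
  obtain ⟨μ, hμ, hμP, hZ, hf, h1, h2⟩ := hv
  have hμ : μ ∈ MartSet Ps S0 S1 :=
    ⟨hμ, hμP, fun i => by rw [convExp_eq_integral (hZ i), ← h1 i]; simp⟩
  refine le_iSup_of_le ⟨μ, hμ⟩ ?_
  rw [convExp_eq_integral hf, ← h2]

/-- **One-period robust superhedging theorem (Bouchard-Nutz).**  Under `NA(𝒫)`,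
`sup_{Q ∈ 𝒬} E_Q[f] = π(f)`, and if `π(f) > -∞` the superhedging price is attained by
some strategy `H`. -/
theorem one_period_robust_superhedging {Ω : Type*} [MeasurableSpace Ω]
    (Ps : Set (Measure Ω)) (hprob : ∀ P ∈ Ps, IsProbabilityMeasure P)
    (hconv : MConvex Ps) {d : ℕ} (S0 : Fin d → ℝ) (S1 : Ω → Fin d → ℝ)
    (hS1 : ∀ i, Measurable fun ω => S1 ω i)
    (hNA : NAcond Ps S0 S1) (f : Ω → ℝ) (hf : Measurable f) :
    (⨆ Q : MartSet Ps S0 S1, convExp (Q : Measure Ω) f) = shPrice Ps S0 S1 f ∧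
    (shPrice Ps S0 S1 f ≠ ⊥ → ∃ H : Fin d → ℝ,
      QS Ps fun ω => (f ω : EReal) ≤ shPrice Ps S0 S1 f + (gain H S0 S1 ω : EReal)) := by
  have hweak : (⨆ Q : MartSet Ps S0 S1, convExp (Q : Measure Ω) f) ≤ shPrice Ps S0 S1 f := by
    refine iSup_le fun Q => le_sInf ?_
    rintro _ ⟨r, rfl, H, hH⟩
    exact convExp_le_of_superhedge hS1 Q.2 hH
  have hempty : Ps = ∅ → shPrice Ps S0 S1 f = ⊥ := by
    rintro rfl
    refine (EReal.eq_bot_iff_forall_lt _).2 fun y => ?_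
    refine lt_of_le_of_lt (sInf_le ⟨y - 1, rfl, 0, Set.univ, MeasurableSet.univ, ?_, ?_⟩)
      (EReal.coe_lt_coe_iff.2 (sub_one_lt y))
    · simp
    · simp
  rcases Ps.eq_empty_or_nonempty with hPs | hne
  · have hbot := hempty hPs
    exact ⟨le_antisymm hweak (hbot ▸ bot_le), fun h => absurd hbot h⟩
  generalize hs : (⨆ Q : MartSet Ps S0 S1, convExp (Q : Measure Ω) f) = s at hweak
  have hle : ∀ v : ℝ, ((0, v) : (Fin d → ℝ) × ℝ) ∈
      momentSet Ps (fun i ω => S1 ω i - S0 i) f → (v : EReal) ≤ s :=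
    fun v hv => hs ▸ coe_le_iSup_convExp hv
  induction s with
  | bot =>
    obtain ⟨v, hv⟩ := exists_zero_mem_momentSet hprob hne hconv hS1 hNA hf
    exact absurd (hle v hv) (by simp)
  | top =>
    rw [top_le_iff] at hweak
    exact ⟨hweak.symm, fun _ => ⟨0, ∅, MeasurableSet.empty, by simp, fun ω _ => by
      simp only [hweak, EReal.top_add_coe, le_top]⟩⟩
  | coe c =>
    obtain ⟨H, hH⟩ := exists_superhedge hprob hne hconv hS1 hNA hf
      (fun v hv => EReal.coe_le_coe_iff.1 (hle v hv))
    have heq : (c : EReal) = shPrice Ps S0 S1 f := le_antisymm hweak (sInf_le ⟨c, rfl, H, hH⟩)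
    refine ⟨heq, fun _ => ⟨H, ?_⟩⟩
    obtain ⟨N, hN, hnull, hp⟩ := hH
    exact ⟨N, hN, hnull, fun ω hω => by rw [← heq]; exact_mod_cast hp ω hω⟩

end RobustHS
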